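/- Let X be a metric star space, k > 0, and φ : X → ℝ with φ ≥ 0. Then SH_k φ is sub-homogeneous: (SH_k φ)(β·u) ≤ β·(SH_k φ)(u) for all β ∈ [0,1] and u ∈ X. -/

import Mathlib

/-- A metric star space structure on a metric space `X`: an action of the
multiplicative monoid `[0,1]` with a root, satisfying the star space axioms. -/
structure StarAction (X : Type*) [MetricSpace X] where
  smul : ℝ → X → X
  root : X
  one_smul : ∀ x, smul 1 x = x
  mul_smul : ∀ α ∈ Set.Icc (0:ℝ) 1, ∀ β ∈ Set.Icc (0:ℝ) 1, ∀ x,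
    smul α (smul β x) = smul (α * β) x
  zero_smul : ∀ x, smul 0 x = root
  dist_smul_le : ∀ α ∈ Set.Icc (0:ℝ) 1, ∀ x y,
    dist (smul α x) (smul α y) ≤ α * dist x y
  dist_smul_smul : ∀ α ∈ Set.Icc (0:ℝ) 1, ∀ β ∈ Set.Icc (0:ℝ) 1, ∀ x,
    dist (smul α x) (smul β x) = |α - β| * dist x root

/-- The sub-homogeneous retraction `SH_k φ` of a function `φ : X → ℝ`:
`(SH_k φ)(u) = inf over α ∈ [0,1], u' ∈ X of (α·φ(u') + k·d(α·u', u))`. -/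
noncomputable def SH {X : Type*} [MetricSpace X] (S : StarAction X) (k : ℝ)
    (φ : X → ℝ) (u : X) : ℝ :=
  ⨅ p : Set.Icc (0:ℝ) 1 × X, ((p.1 : ℝ) * φ p.2 + k * dist (S.smul p.1 p.2) u)

/-- For `k > 0` and `φ ≥ 0`, the function `SH_k φ` is sub-homogeneous. -/
theorem SH_subHomogeneous {X : Type*} [MetricSpace X] (S : StarAction X)
    (k : ℝ) (hk : 0 < k) (φ : X → ℝ) (hφ : ∀ u, 0 ≤ φ u) :
    ∀ β ∈ Set.Icc (0:ℝ) 1, ∀ u, SH S k φ (S.smul β u) ≤ β * SH S k φ u := by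
  intro β hβ u
  have : Nonempty (Set.Icc (0:ℝ) 1 × X) := ⟨(⟨0, by simp⟩, u)⟩
  unfold SH
  rw [Real.mul_iInf_of_nonneg hβ.1]
  refine le_ciInf fun ⟨⟨α, hα⟩, v⟩ => ?_
  have hbdd : BddBelow (Set.range fun p : Set.Icc (0:ℝ) 1 × X =>
      (p.1 : ℝ) * φ p.2 + k * dist (S.smul p.1 p.2) (S.smul β u)) := by
    refine ⟨0, ?_⟩
    rintro _ ⟨p, rfl⟩
    exact add_nonneg (mul_nonneg p.1.2.1 (hφ _)) (mul_nonneg hk.le dist_nonneg)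
  have hβα : β * α ∈ Set.Icc (0:ℝ) 1 :=
    ⟨mul_nonneg hβ.1 hα.1, mul_le_one₀ hβ.2 hα.1 hα.2⟩
  refine (ciInf_le hbdd (⟨β * α, hβα⟩, v)).trans ?_
  have hd := mul_le_mul_of_nonneg_left (S.dist_smul_le β hβ (S.smul α v) u) hk.le
  rw [S.mul_smul β hβ α hα] at hd
  dsimp only
  linarith
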